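/- For j = 1, 2 let S_j be a subgroup of E with −I ∈ S_j, let χ_j : S_j → {1, −1} be a group homomorphism with χ_j(−I) = −1, and set Π_j = (1/|S_j|) Σ_{g∈S_j} χ_j(g)·g. Then trace(Π₁ Π₂) = 2^{i+1} |S₁ ∩ S₂| / (|S₁|·|S₂|) if χ₁ and χ₂ agree on S₁ ∩ S₂, and trace(Π₁ Π₂) = 0 otherwise. -/

import Mathlib

open Matrix BigOperators

/-- `U i = 𝔽₂^i`. -/
abbrev U (i : ℕ) := Fin i → ZMod 2

/-- Standard inner product on `𝔽₂^i`. -/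
def dotp {i : ℕ} (a b : U i) : ZMod 2 := ∑ j, a j * b j

/-- The matrix of the map `X(a) : e_u ↦ e_{u+a}`. -/
def XM {i : ℕ} (a : U i) : Matrix (U i) (U i) ℝ :=
  fun w u => if w = u + a then 1 else 0

/-- The matrix of the map `Y(b) : e_u ↦ (−1)^{b·u} e_u`. -/
def YM {i : ℕ} (b : U i) : Matrix (U i) (U i) ℝ :=
  Matrix.diagonal (fun u => (-1 : ℝ) ^ (dotp b u).val)

/-- The subgroup `E` of `GL(V)` generated by the `X(a)` and the `Y(b)`.
    We realize `GL(V)` as the group of units of the matrix ring. -/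
def Egrp (i : ℕ) : Subgroup (Matrix (U i) (U i) ℝ)ˣ :=
  Subgroup.closure
    {g : (Matrix (U i) (U i) ℝ)ˣ |
      (∃ a : U i, (g : Matrix (U i) (U i) ℝ) = XM a) ∨
      (∃ b : U i, (g : Matrix (U i) (U i) ℝ) = YM b)}

/-- The averaged operator `Π(S, χ) = (1/|S|) Σ_{g∈S} χ(g)·g`. -/
noncomputable def PiMat {i : ℕ} (S : Subgroup (Matrix (U i) (U i) ℝ)ˣ)
    (χ : S →* ℝˣ) : Matrix (U i) (U i) ℝ :=
  (Nat.card S : ℝ)⁻¹ • ∑ᶠ g : S, (χ g : ℝ) • ((g : (Matrix (U i) (U i) ℝ)ˣ) : Matrix (U i) (U i) ℝ)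

/-- The sign `(-1)^c` attached to `c : 𝔽₂`. -/
noncomputable def signZ (c : ZMod 2) : ℝ := (-1 : ℝ) ^ c.val

lemma signZ_zero : signZ 0 = 1 := by simp [signZ]

lemma signZ_one : signZ 1 = -1 := by simp [signZ, ZMod.val_one]

lemma signZ_add (c d : ZMod 2) : signZ (c + d) = signZ c * signZ d := by
  have h : (1 : ZMod 2) + 1 = 0 := by decide
  have hz : ∀ x : ZMod 2, x = 0 ∨ x = 1 := by decide
  rcases hz c with rfl | rfl <;> rcases hz d with rfl | rfl <;> simp [signZ_zero, signZ_one, h]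

lemma U_add_self {i : ℕ} (a : U i) : a + a = 0 :=
  funext fun _ => CharTwo.add_self_eq_zero _

lemma dotp_zero_left {i : ℕ} (u : U i) : dotp 0 u = 0 := by simp [dotp]

lemma dotp_add_left {i : ℕ} (b b' u : U i) : dotp (b + b') u = dotp b u + dotp b' u := by
  simp [dotp, add_mul, Finset.sum_add_distrib]

lemma dotp_add_right {i : ℕ} (b u u' : U i) : dotp b (u + u') = dotp b u + dotp b u' := by
  simp [dotp, mul_add, Finset.sum_add_distrib]

lemma dotp_single {i : ℕ} (b : U i) (j : Fin i) : dotp b (Pi.single j 1) = b j := by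
  simp [dotp, Pi.single_apply]

/-- The matrix of `(-1)^c X(a) Y(b)`. -/
noncomputable def pauli {i : ℕ} (c : ZMod 2) (a b : U i) : Matrix (U i) (U i) ℝ :=
  fun w u => if w = u + a then signZ (c + dotp b u) else 0

lemma pauli_zero {i : ℕ} : pauli 0 (0 : U i) 0 = 1 := by
  ext w u
  simp [pauli, Matrix.one_apply, dotp_zero_left, signZ_zero]

lemma pauli_one {i : ℕ} : pauli 1 (0 : U i) 0 = -1 := by
  ext w u
  by_cases h : w = u <;> simp [pauli, dotp_zero_left, signZ_one, h]

lemma XM_eq_pauli {i : ℕ} (a : U i) : XM a = pauli 0 a 0 := by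
  ext w u
  simp [pauli, XM, dotp_zero_left, signZ_zero]

lemma YM_eq_pauli {i : ℕ} (b : U i) : YM b = pauli 0 0 b := by
  ext w u
  by_cases h : w = u <;> simp [pauli, YM, signZ, h]

lemma pauli_mul {i : ℕ} (c c' : ZMod 2) (a a' b b' : U i) :
    pauli c a b * pauli c' a' b' = pauli (c + c' + dotp b a') (a + a') (b + b') := by
  ext w u
  rw [Matrix.mul_apply, Finset.sum_eq_single (u + a')]
  · have h : u + a' + a = u + (a + a') := by abel
    have hs : signZ (c + dotp b (u + a')) * signZ (c' + dotp b' u) =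
        signZ (c + c' + dotp b a' + dotp (b + b') u) := by
      rw [← signZ_add, dotp_add_left, dotp_add_right]
      congr 1
      ring
    simp [pauli, h, hs]
  · intro v _ hv
    simp [pauli, hv]
  · simp

lemma trace_pauli {i : ℕ} (c : ZMod 2) (a b : U i) (h : a ≠ 0 ∨ b ≠ 0) :
    (pauli c a b).trace = 0 := by
  by_cases ha : a = 0
  · obtain ⟨j, hj⟩ := Function.ne_iff.mp (h.resolve_left (not_not.mpr ha))
    have hj1 : b j = 1 := Fin.eq_one_of_ne_zero (b j) hj
    have hshift : ∑ u : U i, signZ (c + dotp b (u + Pi.single j 1)) =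
        ∑ u : U i, signZ (c + dotp b u) :=
      Fintype.sum_equiv (Equiv.addRight (Pi.single j 1)) _ _ fun _ => rfl
    have hneg : ∀ u : U i, signZ (c + dotp b (u + Pi.single j 1)) = -signZ (c + dotp b u) := by
      intro u
      rw [dotp_add_right, dotp_single, hj1, ← add_assoc, signZ_add _ 1, signZ_one, mul_neg_one]
    simp only [hneg, Finset.sum_neg_distrib] at hshift
    have htr : (pauli c a b).trace = ∑ u : U i, signZ (c + dotp b u) := by
      simp [Matrix.trace, pauli, ha]
    linarith
  · simp [Matrix.trace, pauli, ha]

lemma exists_pauli_of_mem_Egrp {i : ℕ} {g : (Matrix (U i) (U i) ℝ)ˣ} (hg : g ∈ Egrp i) :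
    ∃ c a b, (g : Matrix (U i) (U i) ℝ) = pauli c a b := by
  induction hg using Subgroup.closure_induction with
  | mem g hg =>
    rcases hg with ⟨a, ha⟩ | ⟨b, hb⟩
    · exact ⟨0, a, 0, ha.trans (XM_eq_pauli a)⟩
    · exact ⟨0, 0, b, hb.trans (YM_eq_pauli b)⟩
  | one => exact ⟨0, 0, 0, pauli_zero.symm⟩
  | mul g h _ _ hg hh =>
    obtain ⟨c, a, b, hg⟩ := hg
    obtain ⟨c', a', b', hh⟩ := hh
    exact ⟨_, _, _, by rw [Units.val_mul, hg, hh, pauli_mul]⟩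
  | inv g _ hg =>
    obtain ⟨c, a, b, hg⟩ := hg
    refine ⟨dotp b a + c, a, b, ?_⟩
    rw [← Units.mul_eq_one_iff_inv_eq, hg, pauli_mul]
    convert pauli_zero using 2
    · linear_combination (CharTwo.add_self_eq_zero (c + dotp b a))
    · exact U_add_self a
    · exact U_add_self b

lemma finite_Egrp (i : ℕ) : Finite (Egrp i) := by
  choose c a b h using fun g : Egrp i => exists_pauli_of_mem_Egrp g.2
  refine Finite.of_injective (fun g => (c g, a g, b g)) fun g g' hgg => ?_
  simp only [Prod.mk.injEq] at hgg
  refine Subtype.ext (Units.ext ?_)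
  rw [h g, h g', hgg.1, hgg.2.1, hgg.2.2]

lemma trace_eq_zero_of_mem_Egrp {i : ℕ} {g : (Matrix (U i) (U i) ℝ)ˣ} (hg : g ∈ Egrp i)
    (h1 : g ≠ 1) (h2 : g ≠ -1) : (g : Matrix (U i) (U i) ℝ).trace = 0 := by
  obtain ⟨c, a, b, h⟩ := exists_pauli_of_mem_Egrp hg
  rw [h]
  apply trace_pauli
  by_contra! hab
  rw [hab.1, hab.2] at h
  by_cases hc : c = 0
  · exact h1 (Units.ext (by rw [h, hc, pauli_zero, Units.val_one]))
  · have hc1 : c = 1 := Fin.eq_one_of_ne_zero c hc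
    exact h2 (Units.ext (by rw [h, hc1, pauli_one, Units.val_neg, Units.val_one]))

lemma trace_one_U (i : ℕ) : (1 : Matrix (U i) (U i) ℝ).trace = 2 ^ i := by
  simp [Matrix.trace_one]

lemma one_ne_neg_one_units (i : ℕ) : (1 : (Matrix (U i) (U i) ℝ)ˣ) ≠ -1 := by
  intro h
  have h' := congrArg (fun g : (Matrix (U i) (U i) ℝ)ˣ => (g : Matrix (U i) (U i) ℝ).trace) h
  simp only [Units.val_neg, Units.val_one, Matrix.trace_neg, trace_one_U] at h'
  have : (0 : ℝ) < 2 ^ i := by positivity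
  linarith

/-- For fixed `g`, only `h = g⁻¹` and `h = -g⁻¹` contribute to the sum of traces. -/
lemma sum_mul_trace {i : ℕ} {S : Subgroup (Matrix (U i) (U i) ℝ)ˣ} [Fintype S]
    (hS : S ≤ Egrp i) (hneg : (-1 : (Matrix (U i) (U i) ℝ)ˣ) ∈ S) (χ : S →* ℝˣ)
    (hχ : χ ⟨-1, hneg⟩ = -1) {g : (Matrix (U i) (U i) ℝ)ˣ} (hg : g ∈ Egrp i) [Decidable (g ∈ S)] :
    ∑ h : S, (χ h : ℝ) * ((g * h : (Matrix (U i) (U i) ℝ)ˣ) : Matrix (U i) (U i) ℝ).trace =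
      2 ^ (i + 1) * if hgS : g ∈ S then (((χ ⟨g, hgS⟩)⁻¹ : ℝˣ) : ℝ) else 0 := by
  split_ifs with hgS
  · have hne : (⟨g, hgS⟩⁻¹ : S) ≠ ⟨-1, hneg⟩ * ⟨g, hgS⟩⁻¹ := by
      intro h
      exact one_ne_neg_one_units i (congrArg Subtype.val (right_eq_mul.mp h)).symm
    rw [Fintype.sum_eq_add _ _ hne]
    · have e1 : g * ((⟨g, hgS⟩⁻¹ : S) : (Matrix (U i) (U i) ℝ)ˣ) = 1 := by simp
      have e2 : g * ((⟨-1, hneg⟩ * ⟨g, hgS⟩⁻¹ : S) : (Matrix (U i) (U i) ℝ)ˣ) = -1 := by simp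
      rw [e1, e2, map_mul, hχ, map_inv]
      simp only [Units.val_neg, Units.val_one, Units.val_mul, Matrix.trace_neg, trace_one_U]
      ring
    · rintro h ⟨h1, h2⟩
      rw [trace_eq_zero_of_mem_Egrp (mul_mem hg (hS h.2)), mul_zero]
      · intro hgh
        exact h1 (Subtype.ext (eq_inv_of_mul_eq_one_right hgh))
      · intro hgh
        refine h2 (Subtype.ext ?_)
        simp [eq_inv_mul_of_mul_eq hgh]
  · rw [mul_zero]
    refine Finset.sum_eq_zero fun h _ => ?_
    rw [trace_eq_zero_of_mem_Egrp (mul_mem hg (hS h.2)), mul_zero]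
    · intro hgh
      exact hgS (eq_inv_of_mul_eq_one_left hgh ▸ inv_mem h.2)
    · intro hgh
      exact hgS (eq_mul_inv_of_mul_eq hgh ▸ mul_mem hneg (inv_mem h.2))

/-- The quotient `χ₁ / χ₂` of two characters, on the intersection of their domains. -/
noncomputable def charQuot {G : Type*} [Group G] {S₁ S₂ : Subgroup G}
    (χ₁ : S₁ →* ℝˣ) (χ₂ : S₂ →* ℝˣ) : (S₁ ⊓ S₂ : Subgroup G) →* ℝ :=
  (Units.coeHom ℝ).comp
    (χ₁.comp (Subgroup.inclusion inf_le_left) / χ₂.comp (Subgroup.inclusion inf_le_right))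

lemma charQuot_eq_one_iff {G : Type*} [Group G] {S₁ S₂ : Subgroup G}
    (χ₁ : S₁ →* ℝˣ) (χ₂ : S₂ →* ℝˣ) :
    charQuot χ₁ χ₂ = 1 ↔ ∀ g, ∀ (h₁ : g ∈ S₁) (h₂ : g ∈ S₂), χ₁ ⟨g, h₁⟩ = χ₂ ⟨g, h₂⟩ := by
  constructor
  · intro h g h₁ h₂
    exact div_eq_one.mp (Units.ext (DFunLike.congr_fun h (⟨g, h₁, h₂⟩ : (S₁ ⊓ S₂ : Subgroup G))))
  · intro h
    ext ⟨g, h₁, h₂⟩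
    exact congrArg Units.val (div_eq_one.mpr (h g h₁ h₂))

lemma trace_PiMat_mul {i : ℕ} {S₁ S₂ : Subgroup (Matrix (U i) (U i) ℝ)ˣ}
    (hS₁ : S₁ ≤ Egrp i) (hS₂ : S₂ ≤ Egrp i)
    (hneg₂ : (-1 : (Matrix (U i) (U i) ℝ)ˣ) ∈ S₂) (χ₁ : S₁ →* ℝˣ) (χ₂ : S₂ →* ℝˣ)
    (hχ₂ : χ₂ ⟨-1, hneg₂⟩ = -1) [Fintype (S₁ ⊓ S₂ : Subgroup (Matrix (U i) (U i) ℝ)ˣ)] :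
    (PiMat S₁ χ₁ * PiMat S₂ χ₂).trace =
      2 ^ (i + 1) * (∑ g, charQuot χ₁ χ₂ g) / ((Nat.card S₁ : ℝ) * (Nat.card S₂ : ℝ)) := by
  classical
  have := finite_Egrp i
  have : Finite S₁ := Finite.Set.subset (Egrp i : Set (Matrix (U i) (U i) ℝ)ˣ) hS₁
  have : Finite S₂ := Finite.Set.subset (Egrp i : Set (Matrix (U i) (U i) ℝ)ˣ) hS₂
  have := Fintype.ofFinite S₁
  have := Fintype.ofFinite S₂
  have hsum : ∑ g, charQuot χ₁ χ₂ g = ∑ g : S₁, (χ₁ g : ℝ) *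
      if h : (g : (Matrix (U i) (U i) ℝ)ˣ) ∈ S₂ then (((χ₂ ⟨g, h⟩)⁻¹ : ℝˣ) : ℝ) else 0 := by
    refine Fintype.sum_of_injective (Subgroup.inclusion inf_le_left)
      (Subgroup.inclusion_injective _) _ _ ?_ ?_
    · intro g hg
      rw [dif_neg, mul_zero]
      exact fun h => hg ⟨⟨g, g.2, h⟩, rfl⟩
    · intro g
      rw [dif_pos (show (Subgroup.inclusion inf_le_left g : S₁).1 ∈ S₂ from g.2.2),
        ← Units.val_mul, ← div_eq_mul_inv]
      rfl
  have hprod : ((∑ g : S₁, (χ₁ g : ℝ) • ((g : (Matrix (U i) (U i) ℝ)ˣ) : Matrix (U i) (U i) ℝ)) *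
      ∑ h : S₂, (χ₂ h : ℝ) • ((h : (Matrix (U i) (U i) ℝ)ˣ) : Matrix (U i) (U i) ℝ)).trace =
      2 ^ (i + 1) * ∑ g, charQuot χ₁ χ₂ g := by
    rw [hsum, Finset.sum_mul_sum, Matrix.trace_sum, Finset.mul_sum]
    refine Finset.sum_congr rfl fun g _ => ?_
    rw [mul_left_comm, ← sum_mul_trace hS₂ hneg₂ χ₂ hχ₂ (hS₁ g.2), Matrix.trace_sum,
      Finset.mul_sum]
    refine Finset.sum_congr rfl fun h _ => ?_
    rw [smul_mul_smul_comm, Matrix.trace_smul, Units.val_mul, smul_eq_mul, mul_assoc]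
  rw [PiMat, PiMat, finsum_eq_sum_of_fintype, finsum_eq_sum_of_fintype, smul_mul_smul_comm,
    Matrix.trace_smul, hprod, smul_eq_mul, ← mul_inv, div_eq_inv_mul]

/-- `trace(Π₁Π₂) = 2^{i+1}|S₁ ∩ S₂|/(|S₁||S₂|)` if `χ₁ = χ₂` on
    `S₁ ∩ S₂`, and `trace(Π₁Π₂) = 0` otherwise. -/
theorem stmt8 (i : ℕ) (hi : 0 < i)
    (S₁ S₂ : Subgroup (Matrix (U i) (U i) ℝ)ˣ)
    (hS₁ : S₁ ≤ Egrp i) (hS₂ : S₂ ≤ Egrp i)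
    (hneg₁ : (-1 : (Matrix (U i) (U i) ℝ)ˣ) ∈ S₁)
    (hneg₂ : (-1 : (Matrix (U i) (U i) ℝ)ˣ) ∈ S₂)
    (χ₁ : S₁ →* ℝˣ) (χ₂ : S₂ →* ℝˣ)
    (hval₁ : ∀ s : S₁, (χ₁ s : ℝ) = 1 ∨ (χ₁ s : ℝ) = -1)
    (hval₂ : ∀ s : S₂, (χ₂ s : ℝ) = 1 ∨ (χ₂ s : ℝ) = -1)
    (hχ₁ : χ₁ ⟨-1, hneg₁⟩ = -1) (hχ₂ : χ₂ ⟨-1, hneg₂⟩ = -1) :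
    ((∀ g : (Matrix (U i) (U i) ℝ)ˣ, ∀ (h₁ : g ∈ S₁) (h₂ : g ∈ S₂),
        χ₁ ⟨g, h₁⟩ = χ₂ ⟨g, h₂⟩) →
      Matrix.trace (PiMat S₁ χ₁ * PiMat S₂ χ₂) =
        (2 : ℝ) ^ (i + 1) * (Nat.card (S₁ ⊓ S₂ : Subgroup _) : ℝ) /
          ((Nat.card S₁ : ℝ) * (Nat.card S₂ : ℝ))) ∧
    ((¬ ∀ g : (Matrix (U i) (U i) ℝ)ˣ, ∀ (h₁ : g ∈ S₁) (h₂ : g ∈ S₂),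
        χ₁ ⟨g, h₁⟩ = χ₂ ⟨g, h₂⟩) →
      Matrix.trace (PiMat S₁ χ₁ * PiMat S₂ χ₂) = 0) := by
  classical
  have := finite_Egrp i
  have : Finite (S₁ ⊓ S₂ : Subgroup (Matrix (U i) (U i) ℝ)ˣ) :=
    Finite.Set.subset (Egrp i : Set (Matrix (U i) (U i) ℝ)ˣ) (inf_le_left.trans hS₁)
  have := Fintype.ofFinite (S₁ ⊓ S₂ : Subgroup (Matrix (U i) (U i) ℝ)ˣ)
  rw [trace_PiMat_mul hS₁ hS₂ hneg₂ χ₁ χ₂ hχ₂, sum_hom_units]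
  simp only [← charQuot_eq_one_iff]
  constructor
  · intro h
    rw [if_pos h, Fintype.card_eq_nat_card]
  · intro h
    rw [if_neg h, Nat.cast_zero, mul_zero, zero_div]
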